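/- In every infinite-dimensional Hilbert space H there exist five orthogonal projections Q₁, Q₂, Q₃, Q₄, Q₅, a vector x ∈ H, and a sequence of projections (Pₙ)ₙ≥₁ with each Pₙ ∈ {Q₁, Q₂, Q₃, Q₄, Q₅}, such that the sequence of iterated products Pₙ⋯P₁x does not converge in norm. -/

import Mathlib

open Filter Topology

/-- `P` is an orthogonal projection: idempotent and self-adjoint. -/
def IsOrthoProj {𝕜 H : Type*} [RCLike 𝕜] [NormedAddCommGroup H]
    [InnerProductSpace 𝕜 H] [CompleteSpace H] (P : H →L[𝕜] H) : Prop :=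
  P * P = P ∧ IsSelfAdjoint P

/-- The sequence `x, P₁x, P₂P₁x, …` of iterated applications. -/
noncomputable def iterSeq {𝕜 H : Type*} [RCLike 𝕜] [NormedAddCommGroup H]
    [InnerProductSpace 𝕜 H] (P : ℕ → (H →L[𝕜] H)) (x : H) : ℕ → H
  | 0 => x
  | n + 1 => P (n + 1) (iterSeq P x n)

/-- The real-linear orthogonal projection of `ℂ` onto the line through `h`. -/
noncomputable def lineProj (h : ℂ) : ℂ →L[ℝ] ℂ := (innerSL ℝ h).smulRight h

theorem lineProj_apply (h z : ℂ) : lineProj h z = (inner ℝ h z : ℝ) • h := rfl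

theorem norm_lineProj_le {h : ℂ} (hh : ‖h‖ = 1) : ‖lineProj h‖ ≤ 1 := by
  refine ContinuousLinearMap.opNorm_le_bound _ zero_le_one fun z => ?_
  rw [lineProj_apply, norm_smul, hh, mul_one]
  simpa [hh] using norm_inner_le_norm (𝕜 := ℝ) h z

theorem lineProj_mul_self {h : ℂ} (hh : ‖h‖ = 1) : lineProj h * lineProj h = lineProj h := by
  refine ContinuousLinearMap.ext fun z => ?_
  rw [mul_apply_eq_comp, lineProj_apply, lineProj_apply, inner_smul_right,
    real_inner_self_eq_norm_sq, hh, one_pow, mul_one]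

/-- The operator with eigenvalue `1` along `h` and `a` on the orthogonal complement. -/
noncomputable def lineMix (h : ℂ) (a : ℝ) : ℂ →L[ℝ] ℂ := (1 - a) • lineProj h + a • 1

theorem norm_lineMix_le {h : ℂ} (hh : ‖h‖ = 1) {a : ℝ} (h0 : 0 ≤ a) (h1 : a ≤ 1) :
    ‖lineMix h a‖ ≤ 1 := by
  calc ‖lineMix h a‖ ≤ ‖(1 - a) • lineProj h‖ + ‖a • (1 : ℂ →L[ℝ] ℂ)‖ := norm_add_le _ _
    _ = (1 - a) * ‖lineProj h‖ + a := by
      rw [norm_smul, norm_smul, norm_one, mul_one, Real.norm_of_nonneg h0,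
        Real.norm_of_nonneg (sub_nonneg.2 h1)]
    _ ≤ 1 := by nlinarith [norm_lineProj_le hh, sub_nonneg.2 h1]

theorem lineMix_one (h : ℂ) : lineMix h 1 = 1 := by
  unfold lineMix
  module

theorem lineMix_pow {h : ℂ} (hh : ‖h‖ = 1) (a : ℝ) (m : ℕ) :
    lineMix h a ^ m = lineMix h (a ^ m) := by
  induction m with
  | zero => rw [pow_zero, pow_zero, lineMix_one]
  | succ m ih =>
    rw [pow_succ, ih]
    refine ContinuousLinearMap.ext fun z => ?_
    have e : lineProj h (lineProj h z) = lineProj h z := congr($(lineProj_mul_self hh) z)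
    simp only [lineMix, mul_apply_eq_comp, add_apply, smul_apply, one_apply_eq_self, map_add,
      map_smul, e]
    module

theorem norm_lineMix_sub_lineProj_le {h : ℂ} (hh : ‖h‖ = 1) {a : ℝ} (h0 : 0 ≤ a) :
    ‖lineMix h a - lineProj h‖ ≤ 2 * a := by
  have : lineMix h a - lineProj h = a • (1 - lineProj h) := by
    simp only [lineMix]; module
  rw [this, norm_smul, Real.norm_of_nonneg h0, mul_comm]
  gcongr
  calc _ ≤ ‖(1 : ℂ →L[ℝ] ℂ)‖ + ‖lineProj h‖ := norm_sub_le _ _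
    _ ≤ 2 := by rw [norm_one]; linarith [norm_lineProj_le hh]

/-- A finite family of lines in `ℂ`, with convex weights and decay rates. -/
structure LineSystem (ι : Type) [Fintype ι] where
  dir : ι → ℂ
  weight : ι → ℝ
  rate : ι → ℝ
  norm_dir : ∀ i, ‖dir i‖ = 1
  weight_nonneg : ∀ i, 0 ≤ weight i
  sum_weight : ∑ i, weight i = 1
  rate_nonneg : ∀ i, 0 ≤ rate i

namespace LineSystem

variable {ι : Type} [Fintype ι]

/-- The averaged operator of a system at time `s`. -/
noncomputable def avg (S : LineSystem ι) (s : ℝ) : ℂ →L[ℝ] ℂ :=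
  ∑ i, S.weight i • lineMix (S.dir i) (Real.exp (-(S.rate i * s)))

theorem norm_avg_le (S : LineSystem ι) {s : ℝ} (hs : 0 ≤ s) : ‖S.avg s‖ ≤ 1 := by
  rw [← S.sum_weight]
  refine norm_sum_le_of_le _ fun i _ => ?_
  rw [norm_smul, Real.norm_of_nonneg (S.weight_nonneg i)]
  refine mul_le_of_le_one_right (S.weight_nonneg i)
    (norm_lineMix_le (S.norm_dir i) (Real.exp_nonneg _) ?_)
  simpa using mul_nonneg (S.rate_nonneg i) hs

theorem continuous_avg (S : LineSystem ι) : Continuous S.avg := by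
  unfold avg lineMix
  fun_prop

theorem avg_zero (S : LineSystem ι) : S.avg 0 = 1 := by
  simp only [avg, mul_zero, neg_zero, Real.exp_zero, lineMix_one]
  rw [← Finset.sum_smul, S.sum_weight, one_smul]

/-- Slow a system down by the factor `R` and add the line through `h` with weight `τ`. -/
noncomputable def extend (S : LineSystem ι) (h : ℂ) (hh : ‖h‖ = 1) (τ : ℝ) (h0 : 0 ≤ τ)
    (h1 : τ ≤ 1) (R : ℕ) : LineSystem (Option ι) where
  dir o := o.elim h S.dir
  weight o := o.elim τ fun i => (1 - τ) * S.weight i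
  rate o := o.elim 1 fun i => S.rate i / R
  norm_dir := by rintro (_ | i); exacts [hh, S.norm_dir i]
  weight_nonneg := by
    rintro (_ | i); exacts [h0, mul_nonneg (sub_nonneg.2 h1) (S.weight_nonneg i)]
  sum_weight := by simp [Fintype.sum_option, ← Finset.mul_sum, S.sum_weight]
  rate_nonneg := by
    rintro (_ | i); exacts [zero_le_one, div_nonneg (S.rate_nonneg i) (Nat.cast_nonneg R)]

theorem avg_extend (S : LineSystem ι) (h : ℂ) (hh : ‖h‖ = 1) (τ : ℝ) (h0 : 0 ≤ τ)
    (h1 : τ ≤ 1) (R : ℕ) (s : ℝ) :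
    (S.extend h hh τ h0 h1 R).avg s =
      τ • lineMix h (Real.exp (-s)) + (1 - τ) • S.avg (s / R) := by
  simp [avg, extend, Fintype.sum_option, Finset.smul_sum, smul_smul, div_mul_eq_mul_div,
    mul_div_assoc]

end LineSystem

theorem norm_prod_map_le_one {E : Type*} [SeminormedRing E] [NormOneClass E] {α : Type*}
    {f : α → E}
    (hf : ∀ a, ‖f a‖ ≤ 1) (l : List α) : ‖(l.map f).prod‖ ≤ 1 := by
  induction l with
  | nil => simp
  | cons a l ih =>
    simp only [List.map_cons, List.prod_cons]
    exact (norm_mul_le _ _).trans (mul_le_one₀ (hf a) (norm_nonneg _) ih)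

theorem norm_mul_sub_mul_le {E : Type*} [SeminormedRing E] {a b c d : E} (hb : ‖b‖ ≤ 1)
    (hc : ‖c‖ ≤ 1) : ‖a * b - c * d‖ ≤ ‖a - c‖ + ‖b - d‖ := by
  have : a * b - c * d = (a - c) * b + c * (b - d) := by noncomm_ring
  rw [this]
  refine (norm_add_le _ _).trans (add_le_add ?_ ?_)
  · exact (norm_mul_le _ _).trans (mul_le_of_le_one_right (norm_nonneg _) hb)
  · exact (norm_mul_le _ _).trans (mul_le_of_le_one_left (norm_nonneg _) hc)

theorem norm_prod_map_sub_prod_map_le {E : Type*} [SeminormedRing E] [NormOneClass E] {α : Type*}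
    {f g : α → E} (hf : ∀ a, ‖f a‖ ≤ 1) (hg : ∀ a, ‖g a‖ ≤ 1) {c : ℝ} (hc : ∀ a, ‖f a - g a‖ ≤ c)
    (l : List α) : ‖(l.map f).prod - (l.map g).prod‖ ≤ l.length * c := by
  induction l with
  | nil => simp
  | cons a l ih =>
    simp only [List.map_cons, List.prod_cons, List.length_cons]
    push_cast
    linarith [norm_mul_sub_mul_le (norm_prod_map_le_one hf l) (hg a) (a := f a)
      (d := (l.map g).prod), hc a]

/-- `Q` is a limit of products of averaged operators of line systems. -/
def IsAvgLimit (Q : ℂ →L[ℝ] ℂ) : Prop :=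
  ∀ η : ℝ, 0 < η → ∃ (ι : Type) (_ : Fintype ι) (S : LineSystem ι) (l : List ℕ),
    ‖(l.map fun s : ℕ => S.avg s).prod - Q‖ < η

theorem isAvgLimit_one : IsAvgLimit 1 := fun η hη =>
  ⟨Unit, inferInstance, ⟨fun _ => 1, fun _ => 1, fun _ => 1, by simp, by simp, by simp, by simp⟩,
    [], by simpa using hη⟩

theorem IsAvgLimit.lineProj_mul {Q : ℂ →L[ℝ] ℂ} (hQ : IsAvgLimit Q) {h : ℂ} (hh : ‖h‖ = 1) :
    IsAvgLimit (lineProj h * Q) := by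
  intro η hη
  obtain ⟨ι, _, S, l, hl⟩ := hQ (η / 4) (by positivity)
  obtain ⟨τ, hτ0, hτ1, hτl⟩ : ∃ τ : ℝ, 0 < τ ∧ τ ≤ 1 ∧ l.length * (2 * τ) < η / 4 := by
    refine ⟨min 1 (η / (16 * (l.length + 1))), by positivity, min_le_left _ _, ?_⟩
    have h1 : min 1 (η / (16 * (l.length + 1))) * (16 * (l.length + 1)) ≤ η := by
      rw [← le_div_iff₀ (by positivity)]; exact min_le_right _ _
    have h2 : 0 < min 1 (η / (16 * ((l.length : ℝ) + 1))) := by positivity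
    nlinarith
  set a := Real.exp (-1) with ha
  have ha0 : 0 < a := Real.exp_pos _
  have ha1 : a < 1 := by rw [ha, Real.exp_lt_one_iff]; norm_num
  set b := τ * a + (1 - τ) with hb
  have hb0 : 0 ≤ b := by nlinarith
  have hb1 : b < 1 := by nlinarith
  obtain ⟨m, hm⟩ := exists_pow_lt_of_lt_one (by positivity : 0 < η / 8) hb1
  have hlim : Tendsto (fun R : ℕ => (τ • lineMix h a + (1 - τ) • S.avg (1 / R)) ^ m) atTop
      (𝓝 (lineMix h b ^ m)) := by
    have h1 : Tendsto (fun R : ℕ => S.avg (1 / R)) atTop (𝓝 1) := by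
      rw [← S.avg_zero]
      exact (S.continuous_avg.tendsto 0).comp tendsto_one_div_atTop_nhds_zero_nat
    have h2 : lineMix h b = τ • lineMix h a + (1 - τ) • 1 := by
      simp only [lineMix, hb]; module
    rw [h2]
    exact ((h1.const_smul _).const_add _).pow m
  obtain ⟨R, hR, hR0⟩ := ((Metric.tendsto_nhds.1 hlim (η / 4) (by positivity)).and
    (eventually_gt_atTop 0)).exists
  set S' := S.extend h hh τ hτ0.le hτ1 R with hS'
  have hR0' : (R : ℝ) ≠ 0 := by positivity
  refine ⟨Option ι, inferInstance, S', List.replicate m 1 ++ l.map (R * ·), ?_⟩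
  have hprod : ((List.replicate m 1 ++ l.map (R * ·)).map fun s : ℕ => S'.avg s).prod =
      S'.avg 1 ^ m * (l.map fun s : ℕ => S'.avg (R * s)).prod := by
    simp [Function.comp_def]
  have h1 : ‖S'.avg 1 ^ m - lineProj h‖ < η / 2 := by
    have e1 := norm_lineMix_sub_lineProj_le hh (pow_nonneg hb0 m)
    rw [dist_eq_norm, lineMix_pow hh] at hR
    rw [hS', S.avg_extend]
    have := norm_sub_le_norm_sub_add_norm_sub
      ((τ • lineMix h a + (1 - τ) • S.avg (1 / R)) ^ m) (lineMix h (b ^ m)) (lineProj h)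
    linarith
  have h2 : ‖(l.map fun s : ℕ => S'.avg (R * s)).prod - (l.map fun s : ℕ => S.avg s).prod‖
      ≤ l.length * (2 * τ) := by
    refine norm_prod_map_sub_prod_map_le (fun s => S'.norm_avg_le (by positivity))
      (fun s => S.norm_avg_le (by positivity)) (fun s => ?_) l
    have e : S'.avg (R * s) - S.avg s
        = τ • (lineMix h (Real.exp (-(R * s))) - S.avg s) := by
      rw [hS', S.avg_extend, mul_div_cancel_left₀ _ hR0']; module
    rw [e, norm_smul, Real.norm_of_nonneg hτ0.le, mul_comm]
    gcongr
    refine (norm_sub_le _ _).trans ?_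
    have := S.norm_avg_le (s := s) (by positivity)
    have := norm_lineMix_le hh (Real.exp_nonneg (-(R * s : ℝ)))
      (by simp; positivity)
    linarith
  rw [hprod]
  have h3 := norm_mul_sub_mul_le (a := S'.avg 1 ^ m) (d := Q)
    (norm_prod_map_le_one (fun s : ℕ => S'.norm_avg_le (s := R * s) (by positivity)) l)
    (norm_lineProj_le hh)
  have h4 := norm_sub_le_norm_sub_add_norm_sub (l.map fun s : ℕ => S'.avg (R * s)).prod
    (l.map fun s : ℕ => S.avg s).prod Q
  linarith

/-- Products of averaged operators can nearly rotate `1` to `I`. -/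
theorem exists_avg_quarter_turn {ε : ℝ} (hε : 0 < ε) :
    ∃ (ι : Type) (_ : Fintype ι) (S : LineSystem ι) (l : List ℕ),
      ‖(l.map fun s : ℕ => S.avg s).prod 1 - Complex.I‖ < ε := by
  have key : ∀ (θ : ℝ) (k : ℕ), ∃ Q, IsAvgLimit Q ∧
      Q 1 = (Real.cos θ ^ k : ℝ) • Complex.exp ((k * θ : ℝ) * Complex.I) := by
    intro θ k
    induction k with
    | zero => exact ⟨1, isAvgLimit_one, by simp⟩
    | succ k ih =>
      obtain ⟨Q, hQ, hQ1⟩ := ih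
      refine ⟨_, hQ.lineProj_mul (h := Complex.exp (((k + 1 : ℕ) * θ : ℝ) * Complex.I))
        (Complex.norm_exp_ofReal_mul_I _), ?_⟩
      have e : inner ℝ (Complex.exp (((k + 1 : ℕ) * θ : ℝ) * Complex.I))
          (Complex.exp ((k * θ : ℝ) * Complex.I)) = Real.cos θ := by
        rw [Complex.inner, ← Complex.exp_conj, ← Complex.exp_add, ← Real.cos_neg,
          ← Complex.exp_ofReal_mul_I_re]
        congr 2
        simp
        ring
      rw [mul_apply_eq_comp, hQ1, lineProj_apply, inner_smul_right, e, pow_succ]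
  obtain ⟨k, hk⟩ := exists_nat_gt (max 1 (4 / ε))
  have hk0 : (0 : ℝ) < k := by linarith [le_max_left 1 (4 / ε)]
  have hk1 : 4 < k * ε := by
    rw [← div_lt_iff₀ hε]; exact (le_max_right _ _).trans_lt hk
  obtain ⟨Q, hQ, hQ1⟩ := key (Real.pi / 2 / k) k
  obtain ⟨ι, _, S, l, hl⟩ := hQ (ε / 2) (by positivity)
  refine ⟨ι, inferInstance, S, l, ?_⟩
  have hQI : ‖Q 1 - Complex.I‖ ≤ ε / 2 := by
    have e : Complex.exp ((k * (Real.pi / 2 / k) : ℝ) * Complex.I) = Complex.I := by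
      rw [mul_div_cancel₀ _ hk0.ne']
      push_cast
      exact Complex.exp_pi_div_two_mul_I
    have e2 : Q 1 - Complex.I = (Real.cos (Real.pi / 2 / k) ^ k - 1 : ℝ) • Complex.I := by
      rw [hQ1, e]; module
    rw [e2, norm_smul, Complex.norm_I, mul_one, Real.norm_eq_abs, abs_le]
    set x := Real.pi / 2 / k with hx
    have hxk : x * k = Real.pi / 2 := div_mul_cancel₀ _ hk0.ne'
    have hc := Real.one_sub_sq_div_two_le_cos (x := x)
    have hpi : Real.pi ^ 2 < 16 := by nlinarith [Real.pi_lt_four, Real.pi_pos]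
    have hx2 : x ^ 2 / 2 * k ≤ ε / 2 := by
      have : (x * k) ^ 2 < 4 := by rw [hxk]; nlinarith
      have : (x ^ 2 * k) * k < ε * k := by nlinarith
      have := lt_of_mul_lt_mul_right this hk0.le
      linarith
    have hge : -1 ≤ Real.cos x := Real.neg_one_le_cos x
    have bern := one_add_mul_le_pow (a := Real.cos x - 1) (by linarith) k
    have hp : Real.cos x ^ k ≤ 1 := by
      refine (le_abs_self _).trans ?_
      rw [abs_pow]
      exact pow_le_one₀ (abs_nonneg _) (Real.abs_cos_le_one x)
    rw [add_sub_cancel] at bern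
    constructor <;> nlinarith
  have h1 : ‖((l.map fun s : ℕ => S.avg s).prod - Q) 1‖ < ε / 2 := by
    refine lt_of_le_of_lt ?_ hl
    simpa using ContinuousLinearMap.le_opNorm ((l.map fun s : ℕ => S.avg s).prod - Q) 1
  rw [sub_apply] at h1
  linarith [norm_sub_le_norm_sub_add_norm_sub ((l.map fun s : ℕ => S.avg s).prod 1) (Q 1)
    Complex.I]

section Block

variable {𝕜 H : Type*} [RCLike 𝕜] [NormedAddCommGroup H] [InnerProductSpace 𝕜 H]

theorem mem_orthogonal_span_of_forall {s : Set H} {x : H} (h : ∀ u ∈ s, inner 𝕜 u x = 0) :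
    x ∈ (Submodule.span 𝕜 s)ᗮ := by
  have : Submodule.span 𝕜 s ⟂ Submodule.span 𝕜 {x} :=
    Submodule.isOrtho_span.2 fun u hu v hv => by rw [Set.mem_singleton_iff.1 hv]; exact h u hu
  exact this.symm (Submodule.mem_span_singleton_self x)

/-- Two orthonormal vectors of real coordinates can be realized as two given vectors `g 0`, `g 1`
of an orthonormal sequence, with respect to a suitable orthonormal family in its span. -/
theorem exists_orthonormal_of_coord {κ : Type} [Fintype κ] (hκ : 2 ≤ Fintype.card κ) {g : ℕ → H}
    (hg : Orthonormal 𝕜 g) (a b : κ → ℝ) (haa : ∑ k, a k * a k = 1) (hbb : ∑ k, b k * b k = 1)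
    (hab : ∑ k, a k * b k = 0) :
    ∃ r : κ → H, Orthonormal 𝕜 r ∧ (∀ k, r k ∈ Submodule.span 𝕜 (Set.range g)) ∧
      ∑ k, (a k : 𝕜) • r k = g 0 ∧ ∑ k, (b k : 𝕜) • r k = g 1 ∧
      ∀ P : H →L[𝕜] H, P (g 0) = g 0 → P (g 1) = g 1 → (∀ n, P (g (n + 2)) = 0) →
        ∀ k, P (r k) = (a k : 𝕜) • g 0 + (b k : 𝕜) • g 1 := by
  classical
  obtain ⟨n, hn⟩ := Nat.exists_eq_add_of_le' hκ
  let A : EuclideanSpace 𝕜 κ := WithLp.toLp 2 fun k => (a k : 𝕜)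
  let B : EuclideanSpace 𝕜 κ := WithLp.toLp 2 fun k => (b k : 𝕜)
  have hAA : inner 𝕜 A A = 1 := by
    simp only [A, PiLp.inner_apply, RCLike.inner_apply, RCLike.conj_ofReal]
    exact_mod_cast haa
  have hBB : inner 𝕜 B B = 1 := by
    simp only [B, PiLp.inner_apply, RCLike.inner_apply, RCLike.conj_ofReal]
    exact_mod_cast hbb
  have hAB : inner 𝕜 A B = 0 := by
    simp only [A, B, PiLp.inner_apply, RCLike.inner_apply, RCLike.conj_ofReal]
    rw [← RCLike.ofReal_zero, ← hab]
    push_cast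
    exact Finset.sum_congr rfl fun k _ => mul_comm _ _
  have hBA : inner 𝕜 B A = 0 := inner_eq_zero_symm.1 hAB
  let v : Fin (n + 2) → EuclideanSpace 𝕜 κ := Fin.cons A fun _ => B
  have hv : Orthonormal 𝕜 (({0, 1} : Set (Fin (n + 2))).domRestrict v) := by
    rw [orthonormal_iff_ite]
    rintro ⟨i, rfl | rfl⟩ ⟨j, rfl | rfl⟩ <;>
      simp [-inner_self_eq_norm_sq_to_K, Subtype.ext_iff, v, hAA, hBB, hAB, hBA]
  obtain ⟨β, hβ⟩ := hv.exists_orthonormalBasis_extension_of_card_eq (by simp [hn])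
  have h0 : β 0 = A := hβ 0 (by simp)
  have h1 : β 1 = B := hβ 1 (by simp)
  let L : EuclideanSpace 𝕜 κ →ₗ[𝕜] H :=
    ∑ j : Fin (n + 2), (innerₛₗ 𝕜 (β j)).smulRight (g j)
  have hL (x) : L x = ∑ j : Fin (n + 2), inner 𝕜 (β j) x • g j := by simp [L]
  have hgn : Orthonormal 𝕜 fun j : Fin (n + 2) => g j := hg.comp _ Fin.val_injective
  have hLβ (j : Fin (n + 2)) : L (β j) = g j := by
    rw [hL]
    simp [orthonormal_iff_ite.1 β.orthonormal]
  have hLinner (x y) : inner 𝕜 (L x) (L y) = inner 𝕜 x y := by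
    rw [hL, hL, hgn.inner_sum, ← β.sum_inner_mul_inner]
    simp
  have hsum (x : EuclideanSpace 𝕜 κ) :
      ∑ k, x k • L (EuclideanSpace.basisFun κ 𝕜 k) = L x := by
    simp_rw [← map_smul, ← map_sum]
    congr 1
    simpa using (EuclideanSpace.basisFun κ 𝕜).sum_repr x
  refine ⟨fun k => L (EuclideanSpace.basisFun κ 𝕜 k), ?_, fun k => ?_, ?_, ?_, fun P hP0 hP1 hP k => ?_⟩
  · rw [orthonormal_iff_ite]
    intro i j
    rw [hLinner]
    exact orthonormal_iff_ite.1 (EuclideanSpace.basisFun κ 𝕜).orthonormal i j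
  · beta_reduce
    rw [hL]
    exact Submodule.sum_mem _ fun j _ => Submodule.smul_mem _ _ (Submodule.subset_span ⟨_, rfl⟩)
  · rw [hsum A, ← h0, hLβ]; simp
  · rw [hsum B, ← h1, hLβ]; simp
  · beta_reduce
    rw [hL, Fin.sum_univ_succ, Fin.sum_univ_succ]
    simp [h0, h1, hP0, hP1, hP, A, B, EuclideanSpace.inner_single_right]

/-- The real-linear map `ℂ → H` sending `1` to `u` and `I` to `v`. -/
noncomputable def planeMap (𝕜 : Type*) {H : Type*} [RCLike 𝕜] [NormedAddCommGroup H]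
    [InnerProductSpace 𝕜 H] (u v : H) : ℂ →+ H where
  toFun z := (z.re : 𝕜) • u + (z.im : 𝕜) • v
  map_zero' := by simp
  map_add' z w := by simp only [Complex.add_re, Complex.add_im, RCLike.ofReal_add]; module

theorem planeMap_apply (u v : H) (z : ℂ) :
    planeMap 𝕜 u v z = (z.re : 𝕜) • u + (z.im : 𝕜) • v := rfl

theorem planeMap_smul (u v : H) (c : ℝ) (z : ℂ) :
    planeMap 𝕜 u v (c • z) = (c : 𝕜) • planeMap 𝕜 u v z := by
  simp only [planeMap_apply, Complex.smul_re, Complex.smul_im, smul_eq_mul, RCLike.ofReal_mul]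
  module

theorem norm_planeMap {u v : H} (hu : ‖u‖ = 1) (hv : ‖v‖ = 1) (huv : inner 𝕜 u v = 0) (z : ℂ) :
    ‖planeMap 𝕜 u v z‖ = ‖z‖ := by
  rw [planeMap_apply, ← sq_eq_sq₀ (norm_nonneg _) (norm_nonneg _), sq, sq,
    norm_add_sq_eq_norm_sq_add_norm_sq_of_inner_eq_zero (𝕜 := 𝕜) _ _
      (by rw [inner_smul_left, inner_smul_right, huv, mul_zero, mul_zero]),
    norm_smul, norm_smul, hu, hv, ← sq ‖z‖, Complex.sq_norm, Complex.normSq_apply]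
  simp

theorem lineMix_apply {h : ℂ} (hh : ‖h‖ = 1) (a : ℝ) (z : ℂ) :
    lineMix h a z = (h.re * z.re + h.im * z.im) • h +
      (a * (h.re * z.im - h.im * z.re)) • (Complex.I * h) := by
  have e : h.re * h.re + h.im * h.im = 1 := by
    rw [← Complex.normSq_apply, ← Complex.sq_norm, hh, one_pow]
  apply Complex.ext <;> simp [lineMix, lineProj_apply, Complex.inner]
  · linear_combination a * z.re * (-e)
  · linear_combination a * z.im * (-e)

theorem pow_apply_of_eigen {P : H →L[𝕜] H} {x : H} {c : 𝕜} (h : P x = c • x) (s : ℕ) :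
    (P ^ s) x = c ^ s • x := by
  induction s with
  | zero => simp
  | succ s ih => rw [pow_succ', mul_apply_eq_comp, ih, map_smul, h, smul_smul, pow_succ]

/-- The word `W (X Y X)^s`, with letters `0, 1, 2` for `W, X, Y`. -/
def avgWord (s : ℕ) : List (Fin 3) := 0 :: (List.replicate s [1, 2, 1]).flatten

theorem prod_map_avgWord {M : Type*} [Monoid M] (f : Fin 3 → M) (s : ℕ) :
    ((avgWord s).map f).prod = f 0 * (f 1 * f 2 * f 1) ^ s := by
  simp [avgWord, List.map_flatten, List.prod_flatten, mul_assoc]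

/-- In the span of an orthonormal sequence `g` there are subspaces `X` and `Y` such that
some word in the projections onto `W`, `X` and `Y` moves `g 0` close to `g 1`, where `W` contains
`g 0` and `g 1` and is orthogonal to the other vectors of the sequence. -/
theorem exists_word_moving {ε : ℝ} (hε : 0 < ε) {g : ℕ → H} (hg : Orthonormal 𝕜 g) :
    ∃ (X Y : Submodule 𝕜 H) (w : List (Fin 3)), X ≤ Submodule.span 𝕜 (Set.range g) ∧
      Y ≤ Submodule.span 𝕜 (Set.range g) ∧ ∀ P : Fin 3 → (H →L[𝕜] H),
        P 0 (g 0) = g 0 → P 0 (g 1) = g 1 → (∀ n, P 0 (g (n + 2)) = 0) →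
        (∀ x ∈ X, P 1 x = x) → (∀ x ∈ Submodule.span 𝕜 (Set.range g), x ∈ Xᗮ → P 1 x = 0) →
        (∀ x ∈ Y, P 2 x = x) → (∀ x ∈ Submodule.span 𝕜 (Set.range g), x ∈ Yᗮ → P 2 x = 0) →
        ‖(w.map P).prod (g 0) - g 1‖ < ε := by
  classical
  obtain ⟨ι, _, S, l, hl⟩ := exists_avg_quarter_turn hε
  have hne : Nonempty ι := by
    by_contra hι
    rw [not_nonempty_iff] at hι
    simpa using S.sum_weight
  let a : ι × Fin 3 → ℝ := fun k => √(S.weight k.1) * ![(S.dir k.1).re, -(S.dir k.1).im, 0] k.2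
  let b : ι × Fin 3 → ℝ := fun k => √(S.weight k.1) * ![(S.dir k.1).im, (S.dir k.1).re, 0] k.2
  have hdir (i) : (S.dir i).re * (S.dir i).re + (S.dir i).im * (S.dir i).im = 1 := by
    rw [← Complex.normSq_apply, ← Complex.sq_norm, S.norm_dir, one_pow]
  have hsq (i) : √(S.weight i) * √(S.weight i) = S.weight i :=
    Real.mul_self_sqrt (S.weight_nonneg i)
  obtain ⟨r, hr, hrg, ha, hb, hP⟩ := exists_orthonormal_of_coord (𝕜 := 𝕜) (κ := ι × Fin 3)
    (by
      rw [Fintype.card_prod, Fintype.card_fin]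
      have := Fintype.card_pos (α := ι)
      lia) hg a b
    (by
      rw [← S.sum_weight, Fintype.sum_prod_type]
      refine Finset.sum_congr rfl fun i _ => ?_
      simp only [a, Fin.sum_univ_three]
      simp
      linear_combination hsq i + √(S.weight i) * √(S.weight i) * hdir i)
    (by
      rw [← S.sum_weight, Fintype.sum_prod_type]
      refine Finset.sum_congr rfl fun i _ => ?_
      simp only [b, Fin.sum_univ_three]
      simp
      linear_combination hsq i + √(S.weight i) * √(S.weight i) * hdir i)
    (by
      rw [Fintype.sum_prod_type]
      refine Finset.sum_eq_zero fun i _ => ?_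
      simp only [a, b, Fin.sum_univ_three]
      simp
      ring)
  let d : ι → ℝ := fun i => Real.exp (-S.rate i)
  have hd (i) : √(d i) * √(d i) = d i := Real.mul_self_sqrt (Real.exp_nonneg _)
  have hd' (i) : √(1 - d i) * √(1 - d i) = 1 - d i :=
    Real.mul_self_sqrt (by simpa [d] using S.rate_nonneg i)
  let y : ι → H := fun i => (√(d i) : 𝕜) • r (i, 1) + (√(1 - d i) : 𝕜) • r (i, 2)
  let y' : ι → H := fun i => (√(1 - d i) : 𝕜) • r (i, 1) - (√(d i) : 𝕜) • r (i, 2)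
  have hrr := orthonormal_iff_ite.1 hr
  refine ⟨Submodule.span 𝕜 {x | ∃ i, x = r (i, 0) ∨ x = r (i, 1)},
    Submodule.span 𝕜 {x | ∃ i, x = r (i, 0) ∨ x = y i}, l.flatMap avgWord, ?_, ?_, ?_⟩
  · rw [Submodule.span_le]
    rintro _ ⟨i, rfl | rfl⟩ <;> exact hrg _
  · rw [Submodule.span_le]
    rintro _ ⟨i, rfl | rfl⟩
    · exact hrg _
    · exact Submodule.add_mem _ (Submodule.smul_mem _ _ (hrg _)) (Submodule.smul_mem _ _ (hrg _))
  intro P hW0 hW1 hW hX hX' hY hY'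
  have hXp (i) : P 1 (r (i, 0)) = r (i, 0) := hX _ (Submodule.subset_span ⟨i, Or.inl rfl⟩)
  have hXq (i) : P 1 (r (i, 1)) = r (i, 1) := hX _ (Submodule.subset_span ⟨i, Or.inr rfl⟩)
  have hXq' (i) : P 1 (r (i, 2)) = 0 := by
    refine hX' _ (hrg _) (mem_orthogonal_span_of_forall ?_)
    rintro _ ⟨j, rfl | rfl⟩ <;> simp [hrr]
  have hYp (i) : P 2 (r (i, 0)) = r (i, 0) := hY _ (Submodule.subset_span ⟨i, Or.inl rfl⟩)
  have hYy (i) : P 2 (y i) = y i := hY _ (Submodule.subset_span ⟨i, Or.inr rfl⟩)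
  have hYy' (i) : P 2 (y' i) = 0 := by
    refine hY' _ (Submodule.sub_mem _ (Submodule.smul_mem _ _ (hrg _))
      (Submodule.smul_mem _ _ (hrg _))) (mem_orthogonal_span_of_forall ?_)
    rintro _ ⟨j, rfl | rfl⟩
    · simp [y', hrr, inner_sub_right, inner_smul_right]
    · by_cases hij : j = i
      · subst hij
        simp [-inner_self_eq_norm_sq_to_K, y, y', hrr, inner_sub_right, inner_smul_right,
          inner_add_left, inner_smul_left]
        ring
      · simp [y, y', hrr, inner_sub_right, inner_smul_right, inner_add_left, inner_smul_left, hij]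
  have hq (i) : r (i, 1) = (√(d i) : 𝕜) • y i + (√(1 - d i) : 𝕜) • y' i := by
    have e : (√(d i) : 𝕜) * √(d i) + (√(1 - d i) : 𝕜) * √(1 - d i) = 1 := by
      have := hd i
      have := hd' i
      exact_mod_cast (by linarith : √(d i) * √(d i) + √(1 - d i) * √(1 - d i) = 1)
    calc r (i, 1) = (1 : 𝕜) • r (i, 1) := (one_smul _ _).symm
      _ = _ := by rw [← e]; simp only [y, y']; module
  set T := P 1 * P 2 * P 1 with hT
  have hTp (i) : T (r (i, 0)) = (1 : 𝕜) • r (i, 0) := by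
    simp only [hT, mul_apply_eq_comp, hXp, hYp, one_smul]
  have hTq (i) : T (r (i, 1)) = (d i : 𝕜) • r (i, 1) := by
    simp only [hT, mul_apply_eq_comp, hXq]
    rw [hq, map_add, map_smul, map_smul, hYy, hYy', smul_zero, add_zero, ← hq, map_smul]
    simp only [y, map_add, map_smul, hXq, hXq', smul_zero, add_zero, smul_smul]
    rw [← RCLike.ofReal_mul, hd]
  set Φ := planeMap 𝕜 (g 0) (g 1) with hΦ
  have hWp (i) : P 0 (r (i, 0)) = (√(S.weight i) : 𝕜) • Φ (S.dir i) := by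
    rw [hP (P 0) hW0 hW1 hW, hΦ, planeMap_apply]
    simp [a, b, mul_smul]
  have hWq (i) : P 0 (r (i, 1)) = (√(S.weight i) : 𝕜) • Φ (Complex.I * S.dir i) := by
    rw [hP (P 0) hW0 hW1 hW, hΦ, planeMap_apply]
    simp [a, b, mul_smul]
  have hΦz (z : ℂ) : Φ z = ∑ i, (√(S.weight i) : 𝕜) •
      ((((S.dir i).re * z.re + (S.dir i).im * z.im : ℝ) : 𝕜) • r (i, 0) +
        (((S.dir i).re * z.im - (S.dir i).im * z.re : ℝ) : 𝕜) • r (i, 1)) := by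
    rw [hΦ, planeMap_apply, ← ha, ← hb, Fintype.sum_prod_type, Fintype.sum_prod_type,
      Finset.smul_sum, Finset.smul_sum, ← Finset.sum_add_distrib]
    refine Finset.sum_congr rfl fun i _ => ?_
    simp only [a, b, Fin.sum_univ_three]
    simp
    module
  have havg (s : ℕ) (z : ℂ) : P 0 ((T ^ s) (Φ z)) = Φ (S.avg s z) := by
    rw [hΦz, LineSystem.avg]
    simp only [map_sum, map_smul, map_add, pow_apply_of_eigen (hTp _), pow_apply_of_eigen (hTq _),
      hWp, hWq, sum_apply, smul_apply, lineMix_apply (S.norm_dir _)]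
    refine Finset.sum_congr rfl fun i _ => ?_
    rw [planeMap_smul, map_add, planeMap_smul, planeMap_smul]
    have e : Real.exp (-(S.rate i * s)) = d i ^ s := by
      simp only [d]; rw [← Real.exp_nat_mul]; congr 1; ring
    have e' : (S.weight i : 𝕜) = √(S.weight i) * √(S.weight i) := by
      rw [← RCLike.ofReal_mul, hsq]
    rw [e, e']
    simp only [RCLike.ofReal_add, RCLike.ofReal_sub, RCLike.ofReal_mul, RCLike.ofReal_pow, one_pow]
    module
  have hword (l : List ℕ) (z : ℂ) : ((l.flatMap avgWord).map P).prod (Φ z) =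
      Φ ((l.map fun s : ℕ => S.avg s).prod z) := by
    induction l generalizing z with
    | nil => simp
    | cons s l ih =>
      simp only [List.flatMap_cons, List.map_append, List.prod_append, prod_map_avgWord,
        List.map_cons, List.prod_cons, mul_apply_eq_comp, ih]
      exact havg s _
  have hΦ1 : Φ 1 = g 0 := by simp [hΦ, planeMap_apply]
  have hΦI : Φ Complex.I = g 1 := by simp [hΦ, planeMap_apply]
  rwa [← hΦ1, hword, ← hΦI, ← map_sub, hΦ, norm_planeMap (hg.1 0) (hg.1 1) (hg.2 zero_ne_one)]

end Block

section Gluing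

variable {𝕜 H : Type*} [RCLike 𝕜] [NormedAddCommGroup H] [InnerProductSpace 𝕜 H]

theorem exists_orthonormal_nat (hH : ¬ FiniteDimensional 𝕜 H) :
    ∃ g : ℕ → H, Orthonormal 𝕜 g := by
  let B := Module.Basis.ofVectorSpace 𝕜 H
  have : Infinite (Module.Basis.ofVectorSpaceIndex 𝕜 H) := by
    by_contra h
    rw [not_infinite_iff_finite] at h
    exact hH (Module.Finite.of_basis B)
  exact ⟨_, InnerProductSpace.gramSchmidtNormed_orthonormal
    (B.linearIndependent.comp _ (Infinite.natEmbedding _).injective)⟩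

/-- The state of a machine reading the words `w 0, w 1, …` from right to left, with a pause
before each word: the number of words started and the reversed unread part of the current one. -/
def readState {α : Type*} (w : ℕ → List α) : ℕ → ℕ × List α
  | 0 => (0, [])
  | n + 1 =>
    match readState w n with
    | (i, []) => (i + 1, (w i).reverse)
    | (i, _ :: l) => (i, l)

theorem exists_iterSeq_near {α : Type*} {Q : α → (H →L[𝕜] H)} (hQ : ∀ a x, ‖Q a x‖ ≤ ‖x‖)
    (e : ℕ → H) (w : ℕ → List α) (ε : ℕ → ℝ) (a₀ : α) (ha₀ : ∀ i, Q a₀ (e i) = e i)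
    (hw : ∀ i, ‖((w i).map Q).prod (e i) - e (i + 1)‖ ≤ ε i) :
    ∃ P : ℕ → (H →L[𝕜] H), (∀ n, P n ∈ Set.range Q) ∧
      ∀ i, ∃ t, i ≤ t ∧ ‖iterSeq P (e 0) t - e i‖ ≤ ∑ j ∈ Finset.range i, ε j := by
  let P : ℕ → (H →L[𝕜] H) := fun n => Q ((readState w (n - 1)).2.headD a₀)
  have hword (l : List α) (x : H) : ‖(l.map Q).prod x‖ ≤ ‖x‖ := by
    induction l with
    | nil => simp
    | cons a l ih =>
      rw [List.map_cons, List.prod_cons, mul_apply_eq_comp]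
      exact (hQ _ _).trans ih
  have hrun (i : ℕ) (l : List α) (s : ℕ) (hs : readState w s = (i, l)) :
      readState w (s + l.length) = (i, []) ∧
        iterSeq P (e 0) (s + l.length) = (l.reverse.map Q).prod (iterSeq P (e 0) s) := by
    induction l generalizing s with
    | nil => simpa using hs
    | cons a l ih =>
      have h := ih (s + 1) (by simp only [readState, hs])
      have e : s + (a :: l).length = s + 1 + l.length := by simp; lia
      rw [e]
      refine ⟨h.1, ?_⟩
      rw [h.2]
      simp [iterSeq, P, hs]
  refine ⟨P, fun n => ⟨_, rfl⟩, fun i => ?_⟩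
  suffices ∃ t, i ≤ t ∧ readState w t = (i, []) ∧
      ‖iterSeq P (e 0) t - e i‖ ≤ ∑ j ∈ Finset.range i, ε j by
    obtain ⟨t, h1, -, h2⟩ := this
    exact ⟨t, h1, h2⟩
  induction i with
  | zero => exact ⟨0, le_rfl, rfl, by simp [iterSeq]⟩
  | succ i ih =>
    obtain ⟨t, hit, ht, hxt⟩ := ih
    obtain ⟨h1, h2⟩ := hrun (i + 1) (w i).reverse (t + 1) (by simp only [readState, ht])
    refine ⟨_, by lia, h1, ?_⟩
    have hstep : iterSeq P (e 0) (t + 1) = Q a₀ (iterSeq P (e 0) t) := by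
      simp [iterSeq, P, ht]
    rw [h2, List.reverse_reverse, hstep, Finset.sum_range_succ]
    have h3 : ‖((w i).map Q).prod (Q a₀ (iterSeq P (e 0) t - e i))‖ ≤ ‖iterSeq P (e 0) t - e i‖ :=
      (hword _ _).trans (hQ _ _)
    rw [map_sub, ha₀, map_sub] at h3
    have h4 := norm_sub_le_norm_sub_add_norm_sub (((w i).map Q).prod (Q a₀ (iterSeq P (e 0) t)))
      (((w i).map Q).prod (e i)) (e (i + 1))
    linarith [hw i]

theorem not_tendsto_of_near_orthonormal {e x : ℕ → H} (he : Orthonormal 𝕜 e)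
    (h : ∀ i, ∃ t, i ≤ t ∧ ‖x t - e i‖ ≤ 1 / 4) : ¬ ∃ y, Tendsto x atTop (𝓝 y) := by
  rintro ⟨y, hy⟩
  obtain ⟨N, hN⟩ := Metric.cauchySeq_iff.1 hy.cauchySeq (1 / 2) (by norm_num)
  obtain ⟨s, hs, hs'⟩ := h N
  obtain ⟨t, ht, ht'⟩ := h (N + 1)
  have h1 := hN s hs t (by lia)
  rw [dist_eq_norm] at h1
  have h2 : ‖e N - e (N + 1)‖ * ‖e N - e (N + 1)‖ = 2 := by
    rw [sub_eq_add_neg, norm_add_sq_eq_norm_sq_add_norm_sq_of_inner_eq_zero (𝕜 := 𝕜), norm_neg,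
      he.1, he.1]
    · norm_num
    · rw [inner_neg_right, he.2 (by lia), neg_zero]
  have h3 : ‖e N - e (N + 1)‖ ≤ 1 := by
    have : e N - e (N + 1) = (x s - x t) - (x s - e N) + (x t - e (N + 1)) := by abel
    rw [this]
    refine (norm_add_le _ _).trans ?_
    linarith [norm_sub_le (x s - x t) (x s - e N)]
  nlinarith [norm_nonneg (e N - e (N + 1))]

/-- The index map embedding the sequence of vectors used by the `i`-th block: two consecutive
pivots and a sequence of auxiliary vectors. -/
def blockIndex (i : ℕ) : ℕ → ℕ ⊕ ℕ × ℕ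
  | 0 => Sum.inl i
  | 1 => Sum.inl (i + 1)
  | n + 2 => Sum.inr (i, n)

theorem blockIndex_injective (i : ℕ) : Function.Injective (blockIndex i) := by
  rintro (_ | _ | m) (_ | _ | n) <;> simp [blockIndex]

theorem blockIndex_ne {i j : ℕ} (hij : i ≠ j) (hmod : i % 2 = j % 2) (m n : ℕ) :
    blockIndex i m ≠ blockIndex j n := by
  rcases m with _ | _ | m <;> rcases n with _ | _ | n <;> simp [blockIndex] <;> lia

variable [CompleteSpace H]

/-- The orthogonal projection onto the closure of a subspace. -/
noncomputable def closureProj (S : Submodule 𝕜 H) : H →L[𝕜] H :=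
  S.topologicalClosure.starProjection

theorem isOrthoProj_closureProj (S : Submodule 𝕜 H) : IsOrthoProj (closureProj S) :=
  ⟨S.topologicalClosure.isIdempotentElem_starProjection, isSelfAdjoint_starProjection _⟩

theorem norm_closureProj_apply_le (S : Submodule 𝕜 H) (x : H) : ‖closureProj S x‖ ≤ ‖x‖ :=
  Submodule.norm_starProjection_apply_le _ x

theorem closureProj_of_mem {S : Submodule 𝕜 H} {x : H} (hx : x ∈ S) : closureProj S x = x :=
  Submodule.starProjection_eq_self_iff.2 (S.le_topologicalClosure hx)

theorem closureProj_of_mem_orthogonal {S : Submodule 𝕜 H} {x : H} (hx : x ∈ Sᗮ) :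
    closureProj S x = 0 := by
  rw [closureProj, Submodule.starProjection_apply_eq_zero_iff, Submodule.orthogonal_closure]
  exact hx

/-- The span of those subspaces of a sequence whose index has parity `p`. -/
def paritySup (X : ℕ → Submodule 𝕜 H) (p : ℕ) : Submodule 𝕜 H := ⨆ i : {i : ℕ // i % 2 = p}, X i

theorem closureProj_paritySup_of_mem {X : ℕ → Submodule 𝕜 H} {i : ℕ} {x : H} (hx : x ∈ X i) :
    closureProj (paritySup X (i % 2)) x = x :=
  closureProj_of_mem (le_iSup (fun i' : {i' : ℕ // i' % 2 = i % 2} => X i') ⟨i, rfl⟩ hx)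

theorem closureProj_paritySup_of_mem_orthogonal {X G : ℕ → Submodule 𝕜 H} (hXG : ∀ i, X i ≤ G i)
    (hG : ∀ i j, i ≠ j → i % 2 = j % 2 → G i ⟂ G j) {i : ℕ} {x : H} (hxG : x ∈ G i)
    (hx : x ∈ (X i)ᗮ) : closureProj (paritySup X (i % 2)) x = 0 := by
  refine closureProj_of_mem_orthogonal ?_
  rw [paritySup, ← Submodule.iInf_orthogonal, Submodule.mem_iInf]
  rintro ⟨j, hj⟩
  by_cases hij : i = j
  · exact hij ▸ hx
  · exact Submodule.orthogonal_le (hXG j) (hG i j hij hj.symm hxG)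

end Gluing

/-- In any infinite-dimensional Hilbert space `H` there are five orthogonal projections
`Q₁,…,Q₅`, a vector `x` and a sequence of projections `Pₙ` chosen among `Q₁,…,Q₅`
such that `Pₙ⋯P₁x` does not converge in norm. -/
theorem amemiya_ando_conjecture_falls
    {𝕜 H : Type*} [RCLike 𝕜] [NormedAddCommGroup H] [InnerProductSpace 𝕜 H]
    [CompleteSpace H] (hH : ¬ FiniteDimensional 𝕜 H) :
    ∃ Q : Fin 5 → (H →L[𝕜] H), (∀ i, IsOrthoProj (Q i)) ∧
      ∃ (x : H) (P : ℕ → (H →L[𝕜] H)),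
        (∀ n, P n ∈ Set.range Q) ∧
        ¬ ∃ y : H, Tendsto (iterSeq P x) atTop (𝓝 y) := by
  obtain ⟨g, hg⟩ := exists_orthonormal_nat hH
  obtain ⟨b, hb⟩ : ∃ b : ℕ ⊕ ℕ × ℕ → H, Orthonormal 𝕜 b :=
    ⟨_, hg.comp _ (Encodable.encode_injective (α := ℕ ⊕ ℕ × ℕ))⟩
  have hblock (i : ℕ) : Orthonormal 𝕜 (b ∘ blockIndex i) := hb.comp _ (blockIndex_injective i)
  let ε : ℕ → ℝ := fun i => (1 / 8) * (1 / 2) ^ i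
  choose X Y w hXG hYG hw using fun i : ℕ =>
    exists_word_moving (𝕜 := 𝕜) (by positivity : 0 < ε i) (hblock i)
  let G : ℕ → Submodule 𝕜 H := fun i => Submodule.span 𝕜 (Set.range (b ∘ blockIndex i))
  have hG (i j : ℕ) (hij : i ≠ j) (hmod : i % 2 = j % 2) : G i ⟂ G j := by
    refine Submodule.isOrtho_span.2 ?_
    rintro _ ⟨m, rfl⟩ _ ⟨n, rfl⟩
    exact hb.2 (blockIndex_ne hij hmod m n)
  let e : ℕ → H := fun i => b (Sum.inl i)
  let W : Submodule 𝕜 H := Submodule.span 𝕜 (Set.range e)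
  have hWe (i) : closureProj W (e i) = e i := closureProj_of_mem (Submodule.subset_span ⟨i, rfl⟩)
  have hWf (k) : closureProj W (b (Sum.inr k)) = 0 := by
    refine closureProj_of_mem_orthogonal (mem_orthogonal_span_of_forall ?_)
    rintro _ ⟨i, rfl⟩
    exact hb.2 Sum.inl_ne_inr
  let S : Fin 5 → Submodule 𝕜 H :=
    ![W, paritySup X 0, paritySup Y 0, paritySup X 1, paritySup Y 1]
  let Q : Fin 5 → (H →L[𝕜] H) := fun a => closureProj (S a)
  let letter : ℕ → Fin 3 → Fin 5 := fun i => if i % 2 = 0 then ![0, 1, 2] else ![0, 3, 4]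
  have hl0 (i) : S (letter i 0) = W := by
    rcases Nat.mod_two_eq_zero_or_one i with h | h <;> simp [S, letter, h]
  have hl1 (i) : S (letter i 1) = paritySup X (i % 2) := by
    rcases Nat.mod_two_eq_zero_or_one i with h | h <;> simp [S, letter, h]
  have hl2 (i) : S (letter i 2) = paritySup Y (i % 2) := by
    rcases Nat.mod_two_eq_zero_or_one i with h | h <;> simp [S, letter, h]
  have hmove (i : ℕ) : ‖(((w i).map (letter i)).map Q).prod (e i) - e (i + 1)‖ ≤ ε i := by
    rw [List.map_map]
    refine (hw i (Q ∘ letter i) ?_ ?_ ?_ ?_ ?_ ?_ ?_).le <;>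
      simp only [Q, Function.comp_apply, hl0, hl1, hl2]
    · exact hWe i
    · exact hWe (i + 1)
    · exact fun n => hWf (i, n)
    · exact fun x hx => closureProj_paritySup_of_mem hx
    · exact fun x hxG hx => closureProj_paritySup_of_mem_orthogonal hXG hG hxG hx
    · exact fun x hx => closureProj_paritySup_of_mem hx
    · exact fun x hxG hx => closureProj_paritySup_of_mem_orthogonal hYG hG hxG hx
  obtain ⟨P, hPQ, hP⟩ := exists_iterSeq_near (Q := Q) (fun a x => norm_closureProj_apply_le _ x) e
    (fun i => (w i).map (letter i)) ε 0 hWe hmove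
  refine ⟨Q, fun a => isOrthoProj_closureProj _, e 0, P, hPQ,
    not_tendsto_of_near_orthonormal (𝕜 := 𝕜) (hb.comp _ Sum.inl_injective) fun i => ?_⟩
  obtain ⟨t, hit, ht⟩ := hP i
  refine ⟨t, hit, ht.trans ?_⟩
  rw [← Finset.mul_sum]
  linarith [sum_geometric_two_le i]
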